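/- arXiv:2411.17004 — 10 statements merged into one kernel-verified Lean document; each statement's English description precedes it below -/
import Mathlib

section
/- Let A be a type, z an element of A, and m : A → A → A → A a Mal'cev operation that commutes with itself. Define a + b := m a z b and -a := m z a z. Then (A, +, -, z) is an abelian group, and moreover m a b c = a - b + c for all a, b, c ∈ A. -/
/-- For a Mal'cev operation `m` on `A` that commutes with itself,
with `a + b := m a z b` and `-a := m z a z`, the structure `(A, +, -, z)` is an
abelian group, and `m a b c = a - b + c`. -/
theorem stmt0 {A : Type*} (z : A) (m : A → A → A → A)
    (hm : ∀ x y : A, m x x y = y ∧ m y x x = y)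
    (hself : ∀ x₁ x₂ x₃ y₁ y₂ y₃ z₁ z₂ z₃ : A,
      m (m x₁ x₂ x₃) (m y₁ y₂ y₃) (m z₁ z₂ z₃)
        = m (m x₁ y₁ z₁) (m x₂ y₂ z₂) (m x₃ y₃ z₃)) :
    let add : A → A → A := fun a b => m a z b
    let neg : A → A := fun a => m z a z
    (∀ a b c : A, add (add a b) c = add a (add b c)) ∧
    (∀ a b : A, add a b = add b a) ∧
    (∀ a : A, add z a = a) ∧
    (∀ a : A, add a z = a) ∧
    (∀ a : A, add (neg a) a = z) ∧
    (∀ a : A, add a (neg a) = z) ∧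
    (∀ a b c : A, m a b c = add (add a (neg b)) c) := by
  intro add neg
  have hl (x y : A) : m x x y = y := (hm x y).1
  have hr (x y : A) : m y x x = y := (hm x y).2
  have assoc (a b c d e : A) : m (m a b c) d e = m a b (m c d e) := by
    simpa only [hl, hr] using hself a b c b b d b b e
  have swap (a b c : A) : m a b c = m c b a := by
    simpa only [hl, hr] using hself b b a b b b c b b
  have neg_add (a : A) : add (neg a) a = z := by
    simp only [add, neg, assoc, hl, hr]
  refine ⟨fun a b c => assoc a z b z c, fun a b => swap a z b, hl z, hr z, neg_add,
    fun a => (swap a z (neg a)).trans (neg_add a), fun a b c => ?_⟩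
  simp only [add, neg, ← assoc a z z b z, hr, assoc a b z z c, hl]
end

section
/- Let A be a type and let m, m' : A → A → A → A both be Mal'cev operations such that m commutes with m', i.e., m (m' x₁₁ x₁₂ x₁₃) (m' x₂₁ x₂₂ x₂₃) (m' x₃₁ x₃₂ x₃₃) = m' (m x₁₁ x₂₁ x₃₁) (m x₁₂ x₂₂ x₃₂) (m x₁₃ x₂₃ x₃₃) for all arguments. Then m = m' (the two operations are equal as functions). -/
/-- Two Mal'cev operations on the same type that commute with each
other are equal. -/
theorem stmt1 {A : Type*} (m m' : A → A → A → A)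
    (hm : ∀ x y : A, m x x y = y ∧ m y x x = y)
    (hm' : ∀ x y : A, m' x x y = y ∧ m' y x x = y)
    (hcomm : ∀ x₁₁ x₁₂ x₁₃ x₂₁ x₂₂ x₂₃ x₃₁ x₃₂ x₃₃ : A,
      m (m' x₁₁ x₁₂ x₁₃) (m' x₂₁ x₂₂ x₂₃) (m' x₃₁ x₃₂ x₃₃)
        = m' (m x₁₁ x₂₁ x₃₁) (m x₁₂ x₂₂ x₃₂) (m x₁₃ x₂₃ x₃₃)) :
    m = m' := by
  funext a b c
  simpa only [(hm _ _).1, (hm _ _).2, (hm' _ _).1, (hm' _ _).2] using hcomm a b b b b b b b c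
end

section
/- Let A be a type, m : A → A → A → A a Mal'cev operation, k ≥ 1, and t : (Fin k → A) → A → A a (k+1)-ary operation (with the last argument written separately) that commutes with m, meaning t (fun i => m (x i) (y i) (w i)) (m a b c) = m (t x a) (t y b) (t w c) for all x, y, w : Fin k → A and a, b, c ∈ A. For z ∈ A define t₀ z := t (fun _ => z) z and, for 1 ≤ i ≤ k, tᵢ x z := t (Function.update (fun _ => z) (i-1) x) z. Then for all x : Fin k → A and z ∈ A, t x z equals the left-nested expression m (⋯ m (m (t₁ (x 1) z) (t₀ z) (t₂ (x 2) z)) (t₀ z) (t₃ (x 3) z) ⋯) (t₀ z) (t_k (x k) z), i.e., the fold starting from t₁ (x 1) z which successively combines with t₀ z and tᵢ (x i) z via m. -/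
/-- If `t` commutes with a Mal'cev operation `m`, then a coordinate of the argument of `t` equal
to the base point can be changed by `m`-combination with a unary slice of `t`. -/
theorem malcev_combine_slice {A ι : Type*} [DecidableEq ι] {m : A → A → A → A}
    (hm : ∀ x y : A, m x x y = y ∧ m y x x = y) {t : (ι → A) → A → A}
    (hcomm : ∀ (x y w : ι → A) (a b c : A),
      t (fun i => m (x i) (y i) (w i)) (m a b c) = m (t x a) (t y b) (t w c))
    {y : ι → A} {z : A} {i : ι} (hy : y i = z) (a : A) :
    m (t y z) (t (fun _ => z) z) (t (Function.update (fun _ => z) i a) z) =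
      t (Function.update y i a) z := by
  rw [← hcomm, (hm z z).1]
  congr 1
  ext j
  by_cases hj : j = i
  · subst hj
    simp [hy, (hm z a).1]
  · simp [hj, (hm z (y j)).2]

/-- Successively combining with the unary slices indexed by a list without duplicates changes
exactly the coordinates in that list. -/
theorem malcev_foldl_slices {A ι : Type*} [DecidableEq ι] {m : A → A → A → A}
    (hm : ∀ x y : A, m x x y = y ∧ m y x x = y) {t : (ι → A) → A → A}
    (hcomm : ∀ (x y w : ι → A) (a b c : A),
      t (fun i => m (x i) (y i) (w i)) (m a b c) = m (t x a) (t y b) (t w c))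
    (x : ι → A) (z : A) {l : List ι} (hl : l.Nodup) {y : ι → A} (hy : ∀ i ∈ l, y i = z) :
    List.foldl
        (fun acc i => m acc (t (fun _ => z) z) (t (Function.update (fun _ => z) i (x i)) z))
        (t y z) l =
      t (fun j => if j ∈ l then x j else y j) z := by
  induction l generalizing y with
  | nil => simp
  | cons i l ih =>
    obtain ⟨hi, hl⟩ := List.nodup_cons.mp hl
    rw [List.foldl_cons, malcev_combine_slice hm hcomm (hy i List.mem_cons_self), ih hl]
    · congr 1
      ext j
      by_cases hj : j = i
      · subst hj
        simp [hi]
      · simp [hj]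
    · intro j hj
      rw [Function.update_of_ne (ne_of_mem_of_not_mem hj hi)]
      exact hy j (List.mem_cons_of_mem i hj)


/-- For a `(k+1)`-ary operation `t` commuting with a Mal'cev
operation `m`, the operation `t` decomposes as the left-nested `m`-combination
of its unary slices `tᵢ`. -/
theorem stmt2 {A : Type*} (m : A → A → A → A)
    (hm : ∀ x y : A, m x x y = y ∧ m y x x = y)
    (k : ℕ) (hk : 1 ≤ k)
    (t : (Fin k → A) → A → A)
    (hcomm : ∀ (x y w : Fin k → A) (a b c : A),
      t (fun i => m (x i) (y i) (w i)) (m a b c) = m (t x a) (t y b) (t w c)) :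
    ∀ (x : Fin k → A) (z : A),
      t x z =
        List.foldl
          (fun acc i =>
            m acc (t (fun _ => z) z) (t (Function.update (fun _ => z) i (x i)) z))
          (t (Function.update (fun _ => z) (⟨0, hk⟩ : Fin k) (x ⟨0, hk⟩)) z)
          ((List.finRange k).tail) := by
  intro x z
  obtain ⟨n, rfl⟩ := Nat.exists_eq_add_of_le' hk
  have hnodup := List.nodup_finRange (n + 1)
  rw [List.finRange_succ] at hnodup ⊢
  rw [List.tail_cons, malcev_foldl_slices hm hcomm x z (List.nodup_cons.mp hnodup).2]
  · congr 1
    ext j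
    cases j using Fin.cases <;> simp
  · intro i hi
    obtain ⟨j, -, rfl⟩ := List.mem_map.mp hi
    exact Function.update_of_ne (Fin.succ_ne_zero j) _ _
end

section
/- Let A be a type, m : A → A → A → A a Mal'cev operation, k ≥ 1, and s, t : (Fin k → A) → A → A two (k+1)-ary operations each of which commutes with m (i.e., s (fun i => m (x i) (y i) (w i)) (m a b c) = m (s x a) (s y b) (s w c), and likewise for t). Define s₀ z := s (fun _ => z) z and sᵢ x z := s (Function.update (fun _ => z) (i-1) x) z for 1 ≤ i ≤ k, and similarly t₀, tᵢ. Then s = t (as functions) if and only if s₀ = t₀ and sᵢ = tᵢ for all 1 ≤ i ≤ k. -/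
/-- Two `(k+1)`-ary operations commuting with a Mal'cev operation
`m` are equal iff all their unary slices are equal. -/
theorem stmt3 {A : Type*} (m : A → A → A → A)
    (hm : ∀ x y : A, m x x y = y ∧ m y x x = y)
    (k : ℕ) (hk : 1 ≤ k)
    (s t : (Fin k → A) → A → A)
    (hs : ∀ (x y w : Fin k → A) (a b c : A),
      s (fun i => m (x i) (y i) (w i)) (m a b c) = m (s x a) (s y b) (s w c))
    (ht : ∀ (x y w : Fin k → A) (a b c : A),
      t (fun i => m (x i) (y i) (w i)) (m a b c) = m (t x a) (t y b) (t w c)) :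
    s = t ↔
      ((∀ z : A, s (fun _ => z) z = t (fun _ => z) z) ∧
        ∀ (i : Fin k) (x z : A),
          s (Function.update (fun _ => z) i x) z
            = t (Function.update (fun _ => z) i x) z) := by
  refine ⟨fun h => by simp [h], fun ⟨h0, h1⟩ => ?_⟩
  funext x z
  suffices h : ∀ S : Finset (Fin k),
      s (fun j => if j ∈ S then x j else z) z = t (fun j => if j ∈ S then x j else z) z by
    simpa using h Finset.univ
  intro S
  induction S using Finset.induction_on with
  | empty => simpa using h0 z
  | insert i S hi ih =>
    have e : (fun j => if j ∈ insert i S then x j else z) =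
        fun j => m (if j ∈ S then x j else z) z (Function.update (fun _ => z) i (x i) j) := by
      funext j
      by_cases hj : j = i
      · subst hj
        simp [hi, (hm z (x j)).1]
      · simp [hj, (hm z _).2]
    have hz : m z z z = z := (hm z z).1
    have hs' := hs (fun j => if j ∈ S then x j else z) (fun _ => z)
      (Function.update (fun _ => z) i (x i)) z z z
    have ht' := ht (fun j => if j ∈ S then x j else z) (fun _ => z)
      (Function.update (fun _ => z) i (x i)) z z z
    rw [hz] at hs' ht'
    rw [e, hs', ht', ih, h0, h1]
end

section
/- Let A be a type and m : A → A → A → A a Mal'cev operation that commutes with itself. Let R be the set of binary operations r : A → A → A such that r commutes with m and r is idempotent in the sense that r b b = b for all b ∈ A. Define (r + s) a b := m (r a b) b (s a b), (-r) a b := m b (r a b) b, and (r * s) a b := r (s a b) b. Then R is closed under these operations, and (R, +, -, *) is a ring (possibly noncommutative) with additive identity the second projection (a, b) ↦ b and multiplicative identity the first projection (a, b) ↦ a. -/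
/-- A binary operation `r` commutes with the ternary operation `m`. -/
def CommutesBin {A : Type*} (m : A → A → A → A) (r : A → A → A) : Prop :=
  ∀ x₁ x₂ y₁ y₂ z₁ z₂ : A,
    r (m x₁ y₁ z₁) (m x₂ y₂ z₂) = m (r x₁ x₂) (r y₁ y₂) (r z₁ z₂)

/-- Membership in the ring of idempotent binary operations commuting with `m`. -/
def InRing {A : Type*} (m : A → A → A → A) (r : A → A → A) : Prop :=
  CommutesBin m r ∧ ∀ b : A, r b b = b

section Malcev

variable {A : Type*} {m : A → A → A → A}

theorem malcev_swap (hm : ∀ x y : A, m x x y = y ∧ m y x x = y)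
    (hself : ∀ x₁ x₂ x₃ y₁ y₂ y₃ z₁ z₂ z₃ : A,
      m (m x₁ x₂ x₃) (m y₁ y₂ y₃) (m z₁ z₂ z₃)
        = m (m x₁ y₁ z₁) (m x₂ y₂ z₂) (m x₃ y₃ z₃)) (x y z : A) :
    m x y z = m z y x := by
  simpa only [(hm _ _).1, (hm _ _).2] using hself y y x y y y z y y

theorem malcev_assoc (hm : ∀ x y : A, m x x y = y ∧ m y x x = y)
    (hself : ∀ x₁ x₂ x₃ y₁ y₂ y₃ z₁ z₂ z₃ : A,
      m (m x₁ x₂ x₃) (m y₁ y₂ y₃) (m z₁ z₂ z₃)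
        = m (m x₁ y₁ z₁) (m x₂ y₂ z₂) (m x₃ y₃ z₃)) (x y z b : A) :
    m (m x b y) b z = m x b (m y b z) := by
  simpa only [(hm _ _).1, (hm _ _).2] using hself x b y b b b b b z

theorem malcev_neg_add (hm : ∀ x y : A, m x x y = y ∧ m y x x = y)
    (hself : ∀ x₁ x₂ x₃ y₁ y₂ y₃ z₁ z₂ z₃ : A,
      m (m x₁ x₂ x₃) (m y₁ y₂ y₃) (m z₁ z₂ z₃)
        = m (m x₁ y₁ z₁) (m x₂ y₂ z₂) (m x₃ y₃ z₃)) (x b : A) :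
    m (m b x b) b x = b := by
  simpa only [(hm _ _).1, (hm _ _).2] using hself b x b b b b b b x

theorem InRing.add {r s : A → A → A} (hm : ∀ x y : A, m x x y = y ∧ m y x x = y)
    (hself : ∀ x₁ x₂ x₃ y₁ y₂ y₃ z₁ z₂ z₃ : A,
      m (m x₁ x₂ x₃) (m y₁ y₂ y₃) (m z₁ z₂ z₃)
        = m (m x₁ y₁ z₁) (m x₂ y₂ z₂) (m x₃ y₃ z₃)) (hr : InRing m r) (hs : InRing m s) :
    InRing m fun a b => m (r a b) b (s a b) := by
  refine ⟨fun x₁ x₂ y₁ y₂ z₁ z₂ => ?_, fun b => ?_⟩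
  · simp only [hr.1 x₁ x₂ y₁ y₂ z₁ z₂, hs.1 x₁ x₂ y₁ y₂ z₁ z₂]
    exact hself ..
  · simp only [hr.2, hs.2, (hm _ _).1]

theorem InRing.neg {r : A → A → A} (hm : ∀ x y : A, m x x y = y ∧ m y x x = y)
    (hself : ∀ x₁ x₂ x₃ y₁ y₂ y₃ z₁ z₂ z₃ : A,
      m (m x₁ x₂ x₃) (m y₁ y₂ y₃) (m z₁ z₂ z₃)
        = m (m x₁ y₁ z₁) (m x₂ y₂ z₂) (m x₃ y₃ z₃)) (hr : InRing m r) :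
    InRing m fun a b => m b (r a b) b := by
  refine ⟨fun x₁ x₂ y₁ y₂ z₁ z₂ => ?_, fun b => ?_⟩
  · simp only [hr.1 x₁ x₂ y₁ y₂ z₁ z₂]
    exact hself ..
  · simp only [hr.2, (hm _ _).1]

theorem InRing.mul {r s : A → A → A} (hr : InRing m r) (hs : InRing m s) :
    InRing m fun a b => r (s a b) b := by
  refine ⟨fun x₁ x₂ y₁ y₂ z₁ z₂ => ?_, fun b => ?_⟩
  · simp only [hs.1 x₁ x₂ y₁ y₂ z₁ z₂, hr.1 _ x₂ _ y₂ _ z₂]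
  · simp only [hs.2, hr.2]

theorem InRing.map_add {r : A → A → A} (hm : ∀ x y : A, m x x y = y ∧ m y x x = y)
    (hr : InRing m r) (x y b : A) : r (m x b y) b = m (r x b) b (r y b) := by
  simpa only [(hm _ _).1, hr.2] using hr.1 x b b b y b

end Malcev

/-- The set `R` of idempotent binary operations commuting with a
self-commuting Mal'cev operation `m` is closed under
`(r + s) a b := m (r a b) b (s a b)`, `(-r) a b := m b (r a b) b`,
`(r * s) a b := r (s a b) b`, and `(R, +, -, *)` satisfies the ring axioms, with
zero the second projection and one the first projection. -/
theorem stmt4 {A : Type*} (m : A → A → A → A)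
    (hm : ∀ x y : A, m x x y = y ∧ m y x x = y)
    (hself : ∀ x₁ x₂ x₃ y₁ y₂ y₃ z₁ z₂ z₃ : A,
      m (m x₁ x₂ x₃) (m y₁ y₂ y₃) (m z₁ z₂ z₃)
        = m (m x₁ y₁ z₁) (m x₂ y₂ z₂) (m x₃ y₃ z₃)) :
    let add : (A → A → A) → (A → A → A) → (A → A → A) :=
      fun r s => fun a b => m (r a b) b (s a b)
    let neg : (A → A → A) → (A → A → A) := fun r => fun a b => m b (r a b) b
    let mul : (A → A → A) → (A → A → A) → (A → A → A) :=
      fun r s => fun a b => r (s a b) b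
    let zero : A → A → A := fun _ b => b
    let one : A → A → A := fun a _ => a
    -- closure
    (∀ r s, InRing m r → InRing m s → InRing m (add r s)) ∧
    (∀ r, InRing m r → InRing m (neg r)) ∧
    (∀ r s, InRing m r → InRing m s → InRing m (mul r s)) ∧
    InRing m zero ∧ InRing m one ∧
    -- additive abelian group axioms
    (∀ r s t, InRing m r → InRing m s → InRing m t →
      add (add r s) t = add r (add s t)) ∧
    (∀ r s, InRing m r → InRing m s → add r s = add s r) ∧
    (∀ r, InRing m r → add zero r = r) ∧
    (∀ r, InRing m r → add r zero = r) ∧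
    (∀ r, InRing m r → add (neg r) r = zero) ∧
    (∀ r, InRing m r → add r (neg r) = zero) ∧
    -- multiplicative monoid axioms
    (∀ r s t, InRing m r → InRing m s → InRing m t →
      mul (mul r s) t = mul r (mul s t)) ∧
    (∀ r, InRing m r → mul one r = r) ∧
    (∀ r, InRing m r → mul r one = r) ∧
    -- distributivity
    (∀ r s t, InRing m r → InRing m s → InRing m t →
      mul r (add s t) = add (mul r s) (mul r t)) ∧
    (∀ r s t, InRing m r → InRing m s → InRing m t →
      mul (add r s) t = add (mul r t) (mul s t)) := by
  intro add neg mul zero one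
  have swap := malcev_swap hm hself
  refine ⟨fun r s hr hs => hr.add hm hself hs, fun r hr => hr.neg hm hself,
    fun r s hr hs => hr.mul hs,
    ⟨fun _ _ _ _ _ _ => rfl, fun _ => rfl⟩, ⟨fun _ _ _ _ _ _ => rfl, fun _ => rfl⟩,
    fun r s t _ _ _ => funext₂ fun a b => malcev_assoc hm hself _ _ _ _,
    fun r s _ _ => funext₂ fun a b => swap _ _ _,
    fun r _ => funext₂ fun a b => (hm _ _).1,
    fun r _ => funext₂ fun a b => (hm _ _).2,
    fun r _ => funext₂ fun a b => malcev_neg_add hm hself _ _,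
    fun r _ => funext₂ fun a b => (swap _ _ _).trans (malcev_neg_add hm hself _ _),
    fun _ _ _ _ _ _ => rfl, fun _ _ => rfl, fun _ _ => rfl,
    fun r s t hr _ _ => funext₂ fun a b => hr.map_add hm _ _ _,
    fun _ _ _ _ _ _ => rfl⟩
end

section
/- Let A be a type, m : A → A → A → A a Mal'cev operation, and r : A → A → A a binary operation that commutes with m and is idempotent (r b b = b for all b ∈ A). Then for all p, q, w ∈ A: r p q = m (r p w) (r q w) q. -/
/-- For a Mal'cev operation `m` and an idempotent binary operation
`r` commuting with `m`, we have `r p q = m (r p w) (r q w) q`. -/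
theorem stmt7 {A : Type*} (m : A → A → A → A)
    (hm : ∀ x y : A, m x x y = y ∧ m y x x = y)
    (r : A → A → A)
    (hcomm : ∀ x₁ x₂ y₁ y₂ z₁ z₂ : A,
      r (m x₁ y₁ z₁) (m x₂ y₂ z₂) = m (r x₁ x₂) (r y₁ y₂) (r z₁ z₂))
    (hid : ∀ b : A, r b b = b) :
    ∀ p q w : A, r p q = m (r p w) (r q w) q := by
  intro p q w
  have h := hcomm p w q w q q
  rwa [(hm q p).2, (hm w q).1, hid q] at h
end

section
/- Let A be a type, z ∈ A, and m : A → A → A → A a Mal'cev operation that commutes with itself; write a + b := m a z b (so that (A, +) is an abelian group with identity z). Then for any function f : A → A, the following are equivalent: (1) f z = z and f commutes with m (i.e., f (m a b c) = m (f a) (f b) (f c) for all a, b, c); (2) f is additive, i.e., f (a + b) = f a + f b for all a, b ∈ A. -/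
namespace SelfCommutingMalcev

theorem left_cancel {A : Type*} {m : A → A → A → A}
    (hm : ∀ x y : A, m x x y = y ∧ m y x x = y)
    (hself : ∀ x₁ x₂ x₃ y₁ y₂ y₃ z₁ z₂ z₃ : A,
      m (m x₁ x₂ x₃) (m y₁ y₂ y₃) (m z₁ z₂ z₃)
        = m (m x₁ y₁ z₁) (m x₂ y₂ z₂) (m x₃ y₃ z₃))
    (a b c d : A) : m a b (m b c d) = m a c d := by
  have h := hself a b b b b b b c d
  simpa [hm] using h

theorem right_cancel {A : Type*} {m : A → A → A → A}
    (hm : ∀ x y : A, m x x y = y ∧ m y x x = y)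
    (hself : ∀ x₁ x₂ x₃ y₁ y₂ y₃ z₁ z₂ z₃ : A,
      m (m x₁ x₂ x₃) (m y₁ y₂ y₃) (m z₁ z₂ z₃)
        = m (m x₁ y₁ z₁) (m x₂ y₂ z₂) (m x₃ y₃ z₃))
    (a b c d : A) : m (m a b c) c d = m a b d := by
  have h := hself a b c c c c c c d
  simpa [hm] using h

theorem swap {A : Type*} {m : A → A → A → A}
    (hm : ∀ x y : A, m x x y = y ∧ m y x x = y)
    (hself : ∀ x₁ x₂ x₃ y₁ y₂ y₃ z₁ z₂ z₃ : A,
      m (m x₁ x₂ x₃) (m y₁ y₂ y₃) (m z₁ z₂ z₃)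
        = m (m x₁ y₁ z₁) (m x₂ y₂ z₂) (m x₃ y₃ z₃))
    (a b c : A) : m a b c = m c b a := by
  have h := hself b b a b b b c b b
  simpa [hm] using h

/-- In terms of `a + b := m a z b`, this says `m a b c + b = a + c`. -/
theorem add_middle {A : Type*} {m : A → A → A → A}
    (hm : ∀ x y : A, m x x y = y ∧ m y x x = y)
    (hself : ∀ x₁ x₂ x₃ y₁ y₂ y₃ z₁ z₂ z₃ : A,
      m (m x₁ x₂ x₃) (m y₁ y₂ y₃) (m z₁ z₂ z₃)
        = m (m x₁ y₁ z₁) (m x₂ y₂ z₂) (m x₃ y₃ z₃))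
    (z a b c : A) : m (m a b c) z b = m a z c := by
  have h := hself a b c z z z z z b
  simp only [hm] at h
  rw [h, swap hm hself c, left_cancel hm hself]

end SelfCommutingMalcev

/-- For a self-commuting Mal'cev operation `m` on `A` with chosen
element `z`, and `a + b := m a z b`, a function `f : A → A` fixes `z` and
commutes with `m` if and only if it is additive. -/
theorem stmt8 {A : Type*} (z : A) (m : A → A → A → A)
    (hm : ∀ x y : A, m x x y = y ∧ m y x x = y)
    (hself : ∀ x₁ x₂ x₃ y₁ y₂ y₃ z₁ z₂ z₃ : A,
      m (m x₁ x₂ x₃) (m y₁ y₂ y₃) (m z₁ z₂ z₃)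
        = m (m x₁ y₁ z₁) (m x₂ y₂ z₂) (m x₃ y₃ z₃))
    (f : A → A) :
    (f z = z ∧ ∀ a b c : A, f (m a b c) = m (f a) (f b) (f c)) ↔
      (∀ a b : A, f (m a z b) = m (f a) z (f b)) := by
  constructor
  · rintro ⟨hz, hf⟩ a b
    rw [hf, hz]
  · intro hf
    constructor
    · have h := SelfCommutingMalcev.left_cancel hm hself z (f z) z (f z)
      rw [← hf, (hm z z).1, (hm (f z) z).2, (hm z (f z)).1] at h
      exact h.symm
    · intro a b c
      have h : m (f (m a b c)) z (f b) = m (m (f a) (f b) (f c)) z (f b) := by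
        rw [← hf, SelfCommutingMalcev.add_middle hm hself, hf,
          SelfCommutingMalcev.add_middle hm hself]
      have h' := congrArg (fun x => m x (f b) z) h
      simpa only [SelfCommutingMalcev.right_cancel hm hself, (hm _ _).2] using h'
end

section
/- Let n ∈ ℕ and let T := FreeAlgebra ℤ (Fin n) be the free (noncommutative, unital) ℤ-algebra on n generators, with generators X i := FreeAlgebra.ι ℤ i for i : Fin n. Then the smallest subset of T that contains 0 and 1 and is closed under the ternary operation (a, b, c) ↦ a - b + c and, for each i : Fin n, under the binary operation (a, b) ↦ (X i) * a + (1 - X i) * b, is all of T. -/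
/-- An additive subgroup of a free `ℤ`-algebra that is stable under left multiplication by the
generators is stable under left multiplication by every element. -/
theorem FreeAlgebra.mul_mem_of_ι_mul_mem {X : Type*} (A : AddSubgroup (FreeAlgebra ℤ X))
    (hA : ∀ i, ∀ a ∈ A, FreeAlgebra.ι ℤ i * a ∈ A) (t : FreeAlgebra ℤ X) :
    ∀ a ∈ A, t * a ∈ A := by
  induction t using FreeAlgebra.induction with
  | grade0 k =>
    intro a ha
    rw [← Algebra.smul_def]
    exact A.zsmul_mem ha k
  | grade1 i => exact hA i
  | mul x y hx hy =>
    intro a ha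
    rw [mul_assoc]
    exact hx _ (hy a ha)
  | add x y hx hy =>
    intro a ha
    rw [add_mul]
    exact A.add_mem (hx a ha) (hy a ha)

/-- In the free `ℤ`-algebra on `n` generators, the smallest subset
containing `0` and `1` and closed under `(a, b, c) ↦ a - b + c` and, for each
generator `X i`, under `(a, b) ↦ X i * a + (1 - X i) * b`, is everything:
every such closed subset is all of the algebra. -/
theorem stmt9 (n : ℕ) :
    ∀ S : Set (FreeAlgebra ℤ (Fin n)),
      (0 : FreeAlgebra ℤ (Fin n)) ∈ S →
      (1 : FreeAlgebra ℤ (Fin n)) ∈ S →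
      (∀ a b c : FreeAlgebra ℤ (Fin n), a ∈ S → b ∈ S → c ∈ S → a - b + c ∈ S) →
      (∀ (i : Fin n) (a b : FreeAlgebra ℤ (Fin n)), a ∈ S → b ∈ S →
        FreeAlgebra.ι ℤ i * a + (1 - FreeAlgebra.ι ℤ i) * b ∈ S) →
      S = Set.univ := by
  intro S h0 h1 hm hr
  let A : AddSubgroup (FreeAlgebra ℤ (Fin n)) :=
    { carrier := S
      zero_mem' := h0
      add_mem' := fun {a b} ha hb => by simpa using hm a 0 b ha h0 hb
      neg_mem' := fun {a} ha => by simpa using hm 0 a 0 h0 ha h0 }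
  have hA : ∀ i, ∀ a ∈ A, FreeAlgebra.ι ℤ i * a ∈ A := fun i a ha => by
    have h := hr i a 0 ha h0
    rwa [mul_zero, add_zero] at h
  refine Set.eq_univ_of_forall fun t => ?_
  have h : t * 1 ∈ A := FreeAlgebra.mul_mem_of_ι_mul_mem A hA t 1 h1
  rwa [mul_one] at h
end

section
/- Let ℓ ≤ n be natural numbers, let T := FreeAlgebra ℤ (Fin n) be the free ℤ-algebra on n generators X j := FreeAlgebra.ι ℤ j, and let V := Fin ℓ → T be the free left T-module on ℓ generators, with e i := Pi.single i 1 for i : Fin ℓ (and X i for i : Fin ℓ understood via the inclusion Fin ℓ → Fin n). Then the smallest subset of V that contains 0 and is closed under (v₁, v₂, v₃) ↦ v₁ - v₂ + v₃, under (v₁, v₂) ↦ (X j) • v₁ + (1 - X j) • v₂ for each j : Fin n, and under v ↦ (X i) • v + e i for each i : Fin ℓ, is all of V. -/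
/-- An additive subgroup of a module over a free `ℤ`-algebra that is stable under the generators
is stable under the whole algebra. -/
theorem AddSubgroup.freeAlgebra_smul_mem {X M : Type*} [AddCommGroup M]
    [Module (FreeAlgebra ℤ X) M] (A : AddSubgroup M)
    (hA : ∀ (x : X), ∀ v ∈ A, FreeAlgebra.ι ℤ x • v ∈ A) (a : FreeAlgebra ℤ X) :
    ∀ v ∈ A, a • v ∈ A := by
  induction a using FreeAlgebra.induction with
  | grade0 r =>
    intro v hv
    rw [eq_intCast, Int.cast_smul_eq_zsmul]
    exact A.zsmul_mem hv r
  | grade1 x => exact hA x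
  | mul a b ha hb =>
    intro v hv
    rw [mul_smul]
    exact ha _ (hb v hv)
  | add a b ha hb =>
    intro v hv
    rw [add_smul]
    exact A.add_mem (ha v hv) (hb v hv)

/-- Let `T` be the free `ℤ`-algebra on `n` generators and
`V := Fin ℓ → T` the free left `T`-module on `ℓ` generators (`ℓ ≤ n`), with
standard basis vectors `e i := Pi.single i 1`. The smallest subset of `V`
containing `0` and closed under `(v₁, v₂, v₃) ↦ v₁ - v₂ + v₃`, under
`(v₁, v₂) ↦ X j • v₁ + (1 - X j) • v₂` for each `j : Fin n`, and under
`v ↦ X i • v + e i` for each `i : Fin ℓ`, is all of `V`: every such closed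
subset is all of `V`. -/
theorem stmt10 (ℓ n : ℕ) (h : ℓ ≤ n) :
    ∀ S : Set (Fin ℓ → FreeAlgebra ℤ (Fin n)),
      (0 : Fin ℓ → FreeAlgebra ℤ (Fin n)) ∈ S →
      (∀ v₁ v₂ v₃ : Fin ℓ → FreeAlgebra ℤ (Fin n),
        v₁ ∈ S → v₂ ∈ S → v₃ ∈ S → v₁ - v₂ + v₃ ∈ S) →
      (∀ (j : Fin n) (v₁ v₂ : Fin ℓ → FreeAlgebra ℤ (Fin n)), v₁ ∈ S → v₂ ∈ S →
        FreeAlgebra.ι ℤ j • v₁ + (1 - FreeAlgebra.ι ℤ j) • v₂ ∈ S) →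
      (∀ (i : Fin ℓ) (v : Fin ℓ → FreeAlgebra ℤ (Fin n)), v ∈ S →
        FreeAlgebra.ι ℤ (Fin.castLE h i) • v
          + (Pi.single i 1 : Fin ℓ → FreeAlgebra ℤ (Fin n)) ∈ S) →
      S = Set.univ := by
  intro S h0 hm hr hu
  let A : AddSubgroup (Fin ℓ → FreeAlgebra ℤ (Fin n)) :=
    { carrier := S
      zero_mem' := h0
      add_mem' := fun {v w} hv hw => by simpa using hm v 0 w hv h0 hw
      neg_mem' := fun {v} hv => by simpa using hm 0 v 0 h0 hv h0 }
  have hA := A.freeAlgebra_smul_mem fun j v hv => show _ ∈ S by simpa using hr j v 0 hv h0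
  have he (i : Fin ℓ) : Pi.single i 1 ∈ A := show _ ∈ S by simpa using hu i 0 h0
  refine Set.eq_univ_of_forall fun v => ?_
  change v ∈ A
  rw [← Finset.univ_sum_single v]
  refine A.sum_mem fun i _ => ?_
  simpa [← Pi.single_smul] using hA (v i) _ (he i)
end

section
/- Let R := FreeAlgebra ℤ (Fin 2) be the free (noncommutative, unital) ℤ-algebra on two generators X := FreeAlgebra.ι ℤ 0 and Y := FreeAlgebra.ι ℤ 1. Then the two-sided ideal of R generated by the set { X * Y^n * X | n ∈ ℕ } is not finitely generated as a two-sided ideal: there is no finite subset S of R whose generated two-sided ideal equals the two-sided ideal generated by { X * Y^n * X | n ∈ ℕ }. -/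
open Polynomial in
/-- The `ℤ`-linear map `(a, p, c) ↦ (0, a, p.coeff N)` on `ℤ × ℤ[X] × ℤ`. -/
noncomputable def coeffEnd (N : ℕ) : Module.End ℤ (ℤ × ℤ[X] × ℤ) where
  toFun v := (0, C v.1, v.2.1.coeff N)
  map_add' u v := by simp
  map_smul' m v := by simp

open Polynomial in
/-- The `ℤ`-linear map `(a, p, c) ↦ (0, X * p, 0)` on `ℤ × ℤ[X] × ℤ`. -/
noncomputable def shiftEnd : Module.End ℤ (ℤ × ℤ[X] × ℤ) where
  toFun v := (0, X * v.2.1, 0)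
  map_add' u v := by simp [mul_add]
  map_smul' m v := by simp [mul_left_comm]

open Polynomial in
theorem shiftEnd_pow_apply (n : ℕ) (p : ℤ[X]) (c : ℤ) :
    ∃ c' : ℤ, (shiftEnd ^ n) (0, p, c) = (0, X ^ n * p, c') := by
  induction n with
  | zero => exact ⟨c, by simp⟩
  | succ n ih =>
    obtain ⟨c', h⟩ := ih
    exact ⟨0, by rw [pow_succ', Module.End.mul_apply, h]; simp [shiftEnd, pow_succ', mul_assoc]⟩

open Polynomial in
theorem coeffEnd_mul_shiftEnd_pow_mul_coeffEnd_apply (N n : ℕ) (v : ℤ × ℤ[X] × ℤ) :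
    (coeffEnd N * shiftEnd ^ n * coeffEnd N) v = (0, 0, if N = n then v.1 else 0) := by
  obtain ⟨c, h⟩ := shiftEnd_pow_apply n (C v.1) (v.2.1.coeff N)
  have hv : coeffEnd N v = (0, C v.1, v.2.1.coeff N) := rfl
  rw [Module.End.mul_apply, Module.End.mul_apply, hv, h]
  simp [coeffEnd]

/-- The word `X * Y ^ N * X` is not in the two-sided ideal generated by the words
`X * Y ^ n * X` with `n < N`. -/
theorem FreeAlgebra.ι_mul_pow_mul_ι_notMem_span (N : ℕ) :
    ι ℤ (0 : Fin 2) * ι ℤ (1 : Fin 2) ^ N * ι ℤ (0 : Fin 2) ∉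
      TwoSidedIdeal.span ((fun n : ℕ => ι ℤ (0 : Fin 2) * ι ℤ (1 : Fin 2) ^ n * ι ℤ (0 : Fin 2)) ''
        Set.Iio N) := by
  intro h
  let f := lift ℤ ![coeffEnd N, shiftEnd]
  have hf (n : ℕ) : f (ι ℤ (0 : Fin 2) * ι ℤ (1 : Fin 2) ^ n * ι ℤ (0 : Fin 2)) =
      coeffEnd N * shiftEnd ^ n * coeffEnd N := by simp [f]
  have hker := TwoSidedIdeal.mem_span_iff.1 h (TwoSidedIdeal.ker f) (by
    rintro _ ⟨n, hn, rfl⟩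
    rw [SetLike.mem_coe, TwoSidedIdeal.mem_ker, hf]
    refine LinearMap.ext fun v => ?_
    rw [coeffEnd_mul_shiftEnd_pow_mul_coeffEnd_apply, if_neg (Set.mem_Iio.1 hn).ne']
    rfl)
  rw [TwoSidedIdeal.mem_ker, hf] at hker
  have := coeffEnd_mul_shiftEnd_pow_mul_coeffEnd_apply N N (1, 0, 0)
  simp [hker, Prod.ext_iff] at this

/-- An element of the two-sided ideal generated by the range of a sequence lies in the ideal
generated by an initial segment of the sequence. -/
theorem TwoSidedIdeal.exists_mem_span_image_Iio {R : Type*} [Ring R] (g : ℕ → R) {x : R}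
    (hx : x ∈ span (Set.range g)) : ∃ N, x ∈ span (g '' Set.Iio N) := by
  have mono {M N : ℕ} (h : M ≤ N) : span (g '' Set.Iio M) ≤ span (g '' Set.Iio N) :=
    span_mono (Set.image_mono (Set.Iio_subset_Iio h))
  induction hx using span_induction with
  | mem x hx =>
    obtain ⟨n, rfl⟩ := hx
    exact ⟨n + 1, subset_span ⟨n, Nat.lt_succ_self n, rfl⟩⟩
  | zero => exact ⟨0, zero_mem _⟩
  | add x y _ _ hx hy =>
    obtain ⟨M, hM⟩ := hx
    obtain ⟨N, hN⟩ := hy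
    exact ⟨max M N, add_mem _ (mono (le_max_left M N) hM) (mono (le_max_right M N) hN)⟩
  | neg x _ hx => exact hx.imp fun _ h => neg_mem _ h
  | left_absorb a x _ hx => exact hx.imp fun _ h => mul_mem_left _ _ _ h
  | right_absorb b x _ hx => exact hx.imp fun _ h => mul_mem_right _ _ _ h

/-- If the range of a sequence generates a finitely generated two-sided ideal, then so does an
initial segment of the sequence. -/
theorem TwoSidedIdeal.exists_span_range_le_span_image_Iio {R : Type*} [Ring R] (g : ℕ → R)
    (S : Finset R) (hS : span (S : Set R) = span (Set.range g)) :
    ∃ N, span (Set.range g) ≤ span (g '' Set.Iio N) := by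
  have h (x : R) (hx : x ∈ S) : ∃ N, x ∈ span (g '' Set.Iio N) :=
    exists_mem_span_image_Iio g (hS ▸ subset_span (Finset.mem_coe.2 hx))
  choose! N hN using h
  refine ⟨S.sup N, hS ▸ span_le.2 fun x hx => ?_⟩
  exact span_mono (Set.image_mono (Set.Iio_subset_Iio (Finset.le_sup hx))) (hN x hx)


/-- In the free `ℤ`-algebra on two generators `X, Y`, the
two-sided ideal generated by `{ X * Y^n * X | n ∈ ℕ }` is not finitely
generated as a two-sided ideal. -/
theorem stmt12 :
    ¬ ∃ S : Finset (FreeAlgebra ℤ (Fin 2)),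
        TwoSidedIdeal.span (S : Set (FreeAlgebra ℤ (Fin 2)))
          = TwoSidedIdeal.span
              { x : FreeAlgebra ℤ (Fin 2) |
                ∃ n : ℕ,
                  x = FreeAlgebra.ι ℤ (0 : Fin 2)
                        * FreeAlgebra.ι ℤ (1 : Fin 2) ^ n
                        * FreeAlgebra.ι ℤ (0 : Fin 2) } := by
  rintro ⟨S, hS⟩
  let g (n : ℕ) := FreeAlgebra.ι ℤ (0 : Fin 2) * FreeAlgebra.ι ℤ (1 : Fin 2) ^ n *
    FreeAlgebra.ι ℤ (0 : Fin 2)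
  have hg : {x | ∃ n, x = g n} = Set.range g := by
    ext x
    simp [eq_comm]
  obtain ⟨N, hN⟩ := TwoSidedIdeal.exists_span_range_le_span_image_Iio g S (hg ▸ hS)
  exact FreeAlgebra.ι_mul_pow_mul_ι_notMem_span N
    (hN (TwoSidedIdeal.subset_span (Set.mem_range_self N)))
end
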